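/- Let C be a set in a real vector space, I a finite index set, and A_i, B_i : C → ℝ with A_i(x) > 0 and B_i(x) > 0 for all x ∈ C and all i. If x* ∈ C minimizes x ↦ ∑_i B_i(x)/A_i(x) over C, then the pair (x*, t*) with t*_i = 1/(2·A_i(x*)·B_i(x*)) minimizes the function (x,t) ↦ ∑_i ( t_i·B_i(x)² + 1/(4 t_i·A_i(x)²) ) over C × (0,∞)^I. -/

import Mathlib

/-- Completing the square in the fraction-transformed term. -/
lemma fraction_transform_eq {a b t : ℝ} (ha : a ≠ 0) (ht : t ≠ 0) :
    t * b ^ 2 + 1 / (4 * t * a ^ 2) = b / a + (t * b - 1 / (2 * a)) ^ 2 / t := by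
  field_simp
  ring

lemma div_le_fraction_transform {a t : ℝ} (b : ℝ) (ha : a ≠ 0) (ht : 0 < t) :
    b / a ≤ t * b ^ 2 + 1 / (4 * t * a ^ 2) := by
  rw [fraction_transform_eq ha ht.ne']
  exact le_add_of_nonneg_right (by positivity)

lemma fraction_transform_optimal {a b : ℝ} (ha : a ≠ 0) (hb : b ≠ 0) :
    1 / (2 * a * b) * b ^ 2 + 1 / (4 * (1 / (2 * a * b)) * a ^ 2) = b / a := by
  field_simp
  norm_num

/-- If `x*` minimizes the sum of fractions, then `(x*, t*)` with
`t*_i = 1/(2·A_i(x*)·B_i(x*))` minimizes the fraction-transformed objective. -/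
theorem transform_minimizer_of_sfmin {V : Type*} [AddCommGroup V] [Module ℝ V]
    (C : Set V) (I : Type*) [Fintype I]
    (A B : I → V → ℝ)
    (hA : ∀ i, ∀ x ∈ C, 0 < A i x) (hB : ∀ i, ∀ x ∈ C, 0 < B i x)
    (xs : V) (hxs : xs ∈ C)
    (hmin : ∀ x ∈ C, ∑ i, B i xs / A i xs ≤ ∑ i, B i x / A i x)
    (ts : I → ℝ) (hts : ts = fun i => 1 / (2 * A i xs * B i xs)) :
    ∀ x ∈ C, ∀ t : I → ℝ, (∀ i, 0 < t i) →
      ∑ i, (ts i * (B i xs) ^ 2 + 1 / (4 * ts i * (A i xs) ^ 2)) ≤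
        ∑ i, (t i * (B i x) ^ 2 + 1 / (4 * t i * (A i x) ^ 2)) := by
  subst hts
  intro x hx t ht
  calc
    _ = ∑ i, B i xs / A i xs := Finset.sum_congr rfl fun i _ =>
      fraction_transform_optimal (hA i xs hxs).ne' (hB i xs hxs).ne'
    _ ≤ ∑ i, B i x / A i x := hmin x hx
    _ ≤ _ := Finset.sum_le_sum fun i _ =>
      div_le_fraction_transform (B i x) (hA i x hx).ne' (ht i)
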